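/- Define H₁ : (ρ₋, ρ₊) → ℝ by H₁(ρ) = [(ρ₊ − ρ)(ρ − ρ₋)/Q₀(ρ)²]·√(ρ₊·ρ₋)·(ρ₊ − ρ₋)·( (3/2)·G₀''(ρ) − ẽ₀''(ρ) ) + [ρ₊·ρ₋·(ρ₊ − ρ₋)²/Q₀(ρ)³]·√ρ₋·(ρ − ρ₋)·G₀''(ρ). Then H₁(ρ) ≥ 0 for every ρ ∈ (ρ₋, ρ₊); in particular there is no ρ̄ ∈ (ρ₋, ρ₊) with H₁(ρ̄) < 0. -/

import Mathlib

noncomputable section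

/-- `Q₀(ρ) = (ρ − ρ₋)√ρ₋ + (ρ₊ − ρ)√ρ₊`. -/
def Q0 (ρm ρp ρ : ℝ) : ℝ := (ρ - ρm) * Real.sqrt ρm + (ρp - ρ) * Real.sqrt ρp

/-- `G₀(ρ) = (ρ₊ − ρ)(ρ − ρ₋)(√ρ₋ − √ρ₊)/Q₀(ρ)`. -/
def G0 (ρm ρp ρ : ℝ) : ℝ :=
  (ρp - ρ) * (ρ - ρm) * (Real.sqrt ρm - Real.sqrt ρp) / Q0 ρm ρp ρ

/-- `ẽ₀(ρ) = ρ₊ρ₋(ρ₊ − ρ₋)²/(2 Q₀(ρ)²)`. -/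
def e0 (ρm ρp ρ : ℝ) : ℝ := ρp * ρm * (ρp - ρm) ^ 2 / (2 * Q0 ρm ρp ρ ^ 2)
/-- The function `H₁`. -/
def H1 (ρm ρp ρ : ℝ) : ℝ :=
  ((ρp - ρ) * (ρ - ρm) / Q0 ρm ρp ρ ^ 2) * Real.sqrt (ρp * ρm) * (ρp - ρm) *
      ((3 / 2) * deriv (deriv (G0 ρm ρp)) ρ - deriv (deriv (e0 ρm ρp)) ρ) +
    (ρp * ρm * (ρp - ρm) ^ 2 / Q0 ρm ρp ρ ^ 3) * Real.sqrt ρm * (ρ - ρm) *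
      deriv (deriv (G0 ρm ρp)) ρ

open Real Filter Topology

theorem Q0_pos {ρm ρp ρ : ℝ} (hρm : 0 < ρm) (hρ : ρ ∈ Set.Ioo ρm ρp) : 0 < Q0 ρm ρp ρ := by
  have hm : 0 < √ρm := sqrt_pos.2 hρm
  have hp : 0 < √ρp := sqrt_pos.2 (hρm.trans (hρ.1.trans hρ.2))
  exact add_pos (mul_pos (sub_pos.2 hρ.1) hm) (mul_pos (sub_pos.2 hρ.2) hp)

theorem hasDerivAt_Q0 (ρm ρp ρ : ℝ) : HasDerivAt (Q0 ρm ρp) (√ρm - √ρp) ρ := by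
  have h := (((hasDerivAt_id ρ).sub_const ρm).mul_const √ρm).add
    (((hasDerivAt_id ρ).const_sub ρp).mul_const √ρp)
  exact h.congr_deriv (by ring)

theorem eventually_Q0_ne_zero {ρm ρp ρ : ℝ} (h : Q0 ρm ρp ρ ≠ 0) :
    ∀ᶠ r in 𝓝 ρ, Q0 ρm ρp r ≠ 0 :=
  (hasDerivAt_Q0 ρm ρp ρ).continuousAt.eventually_ne h

theorem hasDerivAt_const_div_Q0_pow (c : ℝ) (n : ℕ) {ρm ρp ρ : ℝ} (h : Q0 ρm ρp ρ ≠ 0) :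
    HasDerivAt (fun r => c / Q0 ρm ρp r ^ (n + 1))
      (c * (n + 1) * (√ρp - √ρm) / Q0 ρm ρp ρ ^ (n + 2)) ρ := by
  have h' := (hasDerivAt_const ρ c).div ((hasDerivAt_Q0 ρm ρp ρ).pow (n + 1))
    (pow_ne_zero (n + 1) h)
  refine h'.congr_deriv ?_
  simp only [Pi.pow_apply, Nat.add_sub_cancel, Nat.cast_add, Nat.cast_one]
  field_simp
  ring

theorem deriv_deriv_e0 {ρm ρp ρ : ℝ} (h : Q0 ρm ρp ρ ≠ 0) :
    deriv (deriv (e0 ρm ρp)) ρ =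
      3 * (ρp * ρm * (ρp - ρm) ^ 2) * (√ρp - √ρm) ^ 2 / Q0 ρm ρp ρ ^ 4 := by
  have he : e0 ρm ρp = fun r => (ρp * ρm * (ρp - ρm) ^ 2 / 2) / Q0 ρm ρp r ^ (1 + 1) := by
    funext r
    rw [e0, div_div]
  have hd : deriv (e0 ρm ρp) =ᶠ[𝓝 ρ]
      fun r => (ρp * ρm * (ρp - ρm) ^ 2 * (√ρp - √ρm)) / Q0 ρm ρp r ^ (2 + 1) := by
    filter_upwards [eventually_Q0_ne_zero h] with r hr
    rw [he, (hasDerivAt_const_div_Q0_pow _ 1 hr).deriv]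
    push_cast
    ring
  rw [hd.deriv_eq, (hasDerivAt_const_div_Q0_pow _ 2 h).deriv]
  push_cast
  ring

theorem deriv_deriv_G0 {ρm ρp ρ : ℝ} (hρm : 0 < ρm) (hρ : ρm < ρp) (h : Q0 ρm ρp ρ ≠ 0) :
    deriv (deriv (G0 ρm ρp)) ρ =
      2 * (√ρm * √ρp * (ρp - ρm) ^ 2) * (√ρp - √ρm) / Q0 ρm ρp ρ ^ 3 := by
  have hk : √ρp - √ρm ≠ 0 := (sub_pos.2 (sqrt_lt_sqrt hρm.le hρ)).ne'
  have hG : ∀ r, Q0 ρm ρp r ≠ 0 → G0 ρm ρp =ᶠ[𝓝 r] fun s =>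
      (Q0 ρm ρp s - (√ρm + √ρp) * (ρp - ρm)) / (√ρp - √ρm) +
        (√ρm * √ρp * (ρp - ρm) ^ 2 / (√ρp - √ρm)) / Q0 ρm ρp s ^ (0 + 1) := by
    intro r hr
    filter_upwards [eventually_Q0_ne_zero hr] with s hs
    rw [G0]
    field_simp
    rw [Q0]
    ring
  have hd : deriv (G0 ρm ρp) =ᶠ[𝓝 ρ]
      fun r => -1 + (√ρm * √ρp * (ρp - ρm) ^ 2) / Q0 ρm ρp r ^ (1 + 1) := by
    filter_upwards [eventually_Q0_ne_zero h] with r hr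
    rw [(hG r hr).deriv_eq, ((((hasDerivAt_Q0 ρm ρp r).sub_const _).div_const _).fun_add
      (hasDerivAt_const_div_Q0_pow _ 0 hr)).deriv]
    push_cast
    field_simp
    ring
  rw [hd.deriv_eq, ((hasDerivAt_const_div_Q0_pow _ 1 h).const_add _).deriv]
  push_cast
  ring

theorem H1_eq {ρm ρp ρ : ℝ} (hρm : 0 < ρm) (hρ : ρ ∈ Set.Ioo ρm ρp) :
    H1 ρm ρp ρ = (ρ - ρm) * (ρp * ρm) * (√ρp - √ρm) ^ 2 * (ρp - ρm) ^ 3 *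
      (3 * ρm * (ρp - ρ) + 3 * (ρp - ρ) ^ 2 + 2 * ρm * √ρp * (√ρm + √ρp)) /
        Q0 ρm ρp ρ ^ 6 := by
  have hQ := (Q0_pos hρm hρ).ne'
  have hp : 0 < ρp := hρm.trans (hρ.1.trans hρ.2)
  rw [H1, deriv_deriv_G0 hρm (hρ.1.trans hρ.2) hQ, deriv_deriv_e0 hQ, sqrt_mul hp.le]
  field_simp
  rw [Q0]
  obtain ⟨a, ha, rfl⟩ : ∃ a, 0 ≤ a ∧ ρm = a ^ 2 := ⟨√ρm, sqrt_nonneg _, (sq_sqrt hρm.le).symm⟩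
  obtain ⟨b, hb, rfl⟩ : ∃ b, 0 ≤ b ∧ ρp = b ^ 2 := ⟨√ρp, sqrt_nonneg _, (sq_sqrt hp.le).symm⟩
  rw [sqrt_sq ha, sqrt_sq hb]
  ring

/-- `H₁(ρ) ≥ 0` for every `ρ ∈ (ρ₋, ρ₊)`; in particular there is no
`ρ̄ ∈ (ρ₋, ρ₊)` with `H₁(ρ̄) < 0`. -/
theorem H1_nonneg (ρm ρp : ℝ) (hρm : 0 < ρm) (hρ : ρm < ρp) :
    (∀ ρ ∈ Set.Ioo ρm ρp, 0 ≤ H1 ρm ρp ρ) ∧ ¬∃ ρ ∈ Set.Ioo ρm ρp, H1 ρm ρp ρ < 0 := by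
  have key : ∀ ρ ∈ Set.Ioo ρm ρp, 0 ≤ H1 ρm ρp ρ := by
    intro ρ h
    have hQ := Q0_pos hρm h
    have hx : 0 ≤ ρ - ρm := sub_nonneg.2 h.1.le
    have hy : 0 ≤ ρp - ρ := sub_nonneg.2 h.2.le
    have hD : 0 ≤ ρp - ρm := sub_nonneg.2 hρ.le
    have hp : 0 < ρp := hρm.trans hρ
    rw [H1_eq hρm h]
    positivity
  exact ⟨key, fun ⟨ρ, h, hneg⟩ => hneg.not_ge (key ρ h)⟩
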